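/- arXiv:2511.11292 — 5 statements merged into one kernel-verified Lean document; each statement's English description precedes it below -/
import Mathlib

section
/- Let X and Y be types, let μ be a subdistribution on X and ν a subdistribution on Y, and let R : X → Y → Prop be a relation. Suppose there exists a coupling η of μ and ν supported on R. Then for every set S ⊆ X and every set T ⊆ Y such that for all x and y, R x y implies (x ∈ S ↔ y ∈ T), the probability of S under μ equals the probability of T under ν, i.e., ∑' x, Set.indicator S μ x = ∑' y, Set.indicator T ν y. -/
/-- A coupling `η` of subdistributions `μ` on `X` and `ν` on `Y` supported on a
relation `R` transfers probabilities of sets: if membership in `S` and `T`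
coincides along `R`, then `Pr_μ[S] = Pr_ν[T]`. -/
theorem coupling_prob_eq {X Y : Type*}
    (μ : X → ENNReal) (ν : Y → ENNReal)
    (hμ : ∑' x, μ x ≤ 1) (hν : ∑' y, ν y ≤ 1)
    (R : X → Y → Prop)
    (hcoupling : ∃ η : X → Y → ENNReal,
      (∀ x, ∑' y, η x y = μ x) ∧
      (∀ y, ∑' x, η x y = ν y) ∧
      (∀ x y, ¬ R x y → η x y = 0))
    (S : Set X) (T : Set Y)
    (hST : ∀ x y, R x y → (x ∈ S ↔ y ∈ T)) :
    ∑' x, Set.indicator S μ x = ∑' y, Set.indicator T ν y := by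
  classical
  obtain ⟨η, h1, h2, h3⟩ := hcoupling
  have hS : ∀ x, Set.indicator S μ x = ∑' y, if x ∈ S then η x y else 0 := by
    intro x
    by_cases hx : x ∈ S
    · simp [hx, h1]
    · simp [hx]
  have hT : ∀ y, Set.indicator T ν y = ∑' x, if y ∈ T then η x y else 0 := by
    intro y
    by_cases hy : y ∈ T
    · simp [hy, h2]
    · simp [hy]
  rw [tsum_congr hS, tsum_congr hT, ENNReal.tsum_comm]
  refine tsum_congr fun y => tsum_congr fun x => ?_
  by_cases hR : R x y
  · simp only [hST x y hR]
  · simp [h3 x y hR]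
end

section
/- Let X and Y be types, let μ be a subdistribution on X and ν a subdistribution on Y, and let R : X → Y → Prop be a relation. Suppose there exists a coupling η of μ and ν supported on R. Then for every set S ⊆ X and every set T ⊆ Y such that for all x and y, R x y and x ∈ S imply y ∈ T, the probability of S under μ is at most the probability of T under ν, i.e., ∑' x, Set.indicator S μ x ≤ ∑' y, Set.indicator T ν y. -/
/-- One-sided variant: if a coupling supported on `R` exists and `R x y ∧ x ∈ S`
implies `y ∈ T`, then `Pr_μ[S] ≤ Pr_ν[T]`. -/
theorem coupling_prob_le {X Y : Type*}
    (μ : X → ENNReal) (ν : Y → ENNReal)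
    (hμ : ∑' x, μ x ≤ 1) (hν : ∑' y, ν y ≤ 1)
    (R : X → Y → Prop)
    (hcoupling : ∃ η : X → Y → ENNReal,
      (∀ x, ∑' y, η x y = μ x) ∧
      (∀ y, ∑' x, η x y = ν y) ∧
      (∀ x y, ¬ R x y → η x y = 0))
    (S : Set X) (T : Set Y)
    (hST : ∀ x y, R x y → x ∈ S → y ∈ T) :
    ∑' x, Set.indicator S μ x ≤ ∑' y, Set.indicator T ν y := by
  classical
  obtain ⟨η, h1, h2, h3⟩ := hcoupling
  calc ∑' x, Set.indicator S μ x
      = ∑' x, ∑' y, (if x ∈ S then η x y else 0) := by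
        refine tsum_congr fun x => ?_
        by_cases hx : x ∈ S
        · simp [hx, h1]
        · simp [hx]
    _ = ∑' y, ∑' x, (if x ∈ S then η x y else 0) := ENNReal.tsum_comm
    _ ≤ ∑' y, Set.indicator T ν y := by
        refine ENNReal.tsum_le_tsum fun y => ?_
        by_cases hy : y ∈ T
        · rw [Set.indicator_of_mem hy, ← h2 y]
          refine ENNReal.tsum_le_tsum fun x => ?_
          split_ifs
          · exact le_rfl
          · exact zero_le
        · have h0 : ∀ x, (if x ∈ S then η x y else 0) = 0 := by
            intro x
            split_ifs with hx
            · exact h3 x y fun hR => hy (hST x y hR hx)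
            · rfl
          simp [h0]
end

section
/- Let X, Y, Z be types, let μ, ν, ρ be subdistributions on X, Y, Z respectively, and let R₁ : X → Y → Prop and R₂ : Y → Z → Prop be relations. Suppose η₁ is a coupling of μ and ν supported on R₁, and η₂ is a coupling of ν and ρ supported on R₂. Then there exists a coupling of μ and ρ supported on the relational composition R₁ ;; R₂, where (R₁ ;; R₂) x z holds iff there exists y with R₁ x y and R₂ y z. (One such coupling is η x z = ∑' y, η₁ x y * η₂ y z / ν y, with the convention that the summand is 0 when ν y = 0.) -/
/-- Gluing lemma: couplings supported on `R₁` and `R₂` compose to a coupling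
supported on the relational composition of `R₁` and `R₂`. -/
theorem coupling_comp {X Y Z : Type*}
    (μ : X → ENNReal) (ν : Y → ENNReal) (ρ : Z → ENNReal)
    (hμ : ∑' x, μ x ≤ 1) (hν : ∑' y, ν y ≤ 1) (hρ : ∑' z, ρ z ≤ 1)
    (R₁ : X → Y → Prop) (R₂ : Y → Z → Prop)
    (η₁ : X → Y → ENNReal) (η₂ : Y → Z → ENNReal)
    (hη₁_fst : ∀ x, ∑' y, η₁ x y = μ x)
    (hη₁_snd : ∀ y, ∑' x, η₁ x y = ν y)
    (hη₁_supp : ∀ x y, ¬ R₁ x y → η₁ x y = 0)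
    (hη₂_fst : ∀ y, ∑' z, η₂ y z = ν y)
    (hη₂_snd : ∀ z, ∑' y, η₂ y z = ρ z)
    (hη₂_supp : ∀ y z, ¬ R₂ y z → η₂ y z = 0) :
    ∃ η : X → Z → ENNReal,
      (∀ x, ∑' z, η x z = μ x) ∧
      (∀ z, ∑' x, η x z = ρ z) ∧
      (∀ x z, ¬ (∃ y, R₁ x y ∧ R₂ y z) → η x z = 0) := by
  have hν_top : ∀ y, ν y ≠ ⊤ := fun y =>
    ne_top_of_le_ne_top ENNReal.one_ne_top ((ENNReal.le_tsum y).trans hν)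
  have h1 : ∀ x y, η₁ x y ≤ ν y := fun x y => (ENNReal.le_tsum x).trans (hη₁_snd y).le
  have h2 : ∀ y z, η₂ y z ≤ ν y := fun y z => (ENNReal.le_tsum z).trans (hη₂_fst y).le
  have cancel : ∀ y a, a ≤ ν y → a * ((ν y)⁻¹ * ν y) = a := by
    intro y a ha
    by_cases h0 : ν y = 0
    · have : a = 0 := le_antisymm (h0 ▸ ha) zero_le
      simp [this]
    · rw [ENNReal.inv_mul_cancel h0 (hν_top y), mul_one]
  refine ⟨fun x z => ∑' y, η₁ x y * ((ν y)⁻¹ * η₂ y z), ?_, ?_, ?_⟩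
  · intro x
    rw [ENNReal.tsum_comm, ← hη₁_fst x]
    refine tsum_congr fun y => ?_
    rw [ENNReal.tsum_mul_left, ENNReal.tsum_mul_left, hη₂_fst, cancel y _ (h1 x y)]
  · intro z
    rw [ENNReal.tsum_comm, ← hη₂_snd z]
    refine tsum_congr fun y => ?_
    rw [ENNReal.tsum_mul_right, hη₁_snd, ← mul_assoc, mul_comm, mul_comm (ν y),
      cancel y _ (h2 y z)]
  · intro x z hxz
    refine ENNReal.tsum_eq_zero.2 fun y => ?_
    by_cases hR : R₁ x y
    · have : η₂ y z = 0 := hη₂_supp y z fun h => hxz ⟨y, hR, h⟩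
      simp [this]
    · simp [hη₁_supp x y hR]
end

section
/- Let X and Y be types, R : X → Y → Prop a relation, and (μₙ), (νₙ), (ηₙ) sequences such that each μₙ is a subdistribution on X, each νₙ is a subdistribution on Y, each ηₙ is a coupling of μₙ and νₙ supported on R, and the sequences are pointwise monotone: μₙ x ≤ μₙ₊₁ x, νₙ y ≤ νₙ₊₁ y, and ηₙ x y ≤ ηₙ₊₁ x y for all n, x, y. Then η x y := ⨆ n, ηₙ x y is a coupling, supported on R, of μ x := ⨆ n, μₙ x and ν y := ⨆ n, νₙ y. -/
theorem tsum_iSup_of_mono_aux {A : Type*} (f : ℕ → A → ENNReal)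
    (hf : ∀ n a, f n a ≤ f (n + 1) a) :
    ∑' a, (⨆ n, f n a) = ⨆ n, ∑' a, f n a := by
  simp_rw [ENNReal.tsum_eq_iSup_sum]
  rw [iSup_comm]
  refine iSup_congr fun s => ?_
  exact ENNReal.finsetSum_iSup_of_monotone fun a => monotone_nat_of_le_succ fun n => hf n a

/-- Pointwise suprema of monotone sequences of couplings form a coupling of the
pointwise suprema (which are subdistributions), supported on the same
relation. -/
theorem coupling_iSup {X Y : Type*}
    (R : X → Y → Prop)
    (μseq : ℕ → X → ENNReal) (νseq : ℕ → Y → ENNReal)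
    (ηseq : ℕ → X → Y → ENNReal)
    (hμsub : ∀ n, ∑' x, μseq n x ≤ 1)
    (hνsub : ∀ n, ∑' y, νseq n y ≤ 1)
    (hη_fst : ∀ n x, ∑' y, ηseq n x y = μseq n x)
    (hη_snd : ∀ n y, ∑' x, ηseq n x y = νseq n y)
    (hη_supp : ∀ n x y, ¬ R x y → ηseq n x y = 0)
    (hμmono : ∀ n x, μseq n x ≤ μseq (n + 1) x)
    (hνmono : ∀ n y, νseq n y ≤ νseq (n + 1) y)
    (hηmono : ∀ n x y, ηseq n x y ≤ ηseq (n + 1) x y) :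
    (∑' x, (⨆ n, μseq n x) ≤ 1) ∧
    (∑' y, (⨆ n, νseq n y) ≤ 1) ∧
    (∀ x, ∑' y, (⨆ n, ηseq n x y) = ⨆ n, μseq n x) ∧
    (∀ y, ∑' x, (⨆ n, ηseq n x y) = ⨆ n, νseq n y) ∧
    (∀ x y, ¬ R x y → (⨆ n, ηseq n x y) = 0) := by
  refine ⟨?_, ?_, fun x => ?_, fun y => ?_, fun x y h => ?_⟩
  · rw [tsum_iSup_of_mono_aux μseq hμmono]
    exact iSup_le hμsub
  · rw [tsum_iSup_of_mono_aux νseq hνmono]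
    exact iSup_le hνsub
  · rw [tsum_iSup_of_mono_aux (fun n y => ηseq n x y) fun n y => hηmono n x y]
    exact iSup_congr fun n => hη_fst n x
  · rw [tsum_iSup_of_mono_aux (fun n x => ηseq n x y) fun n x => hηmono n x y]
    exact iSup_congr fun n => hη_snd n y
  · simp [hη_supp _ x y h]
end

section
/- Let X, Y, X', Y' be types, μ : PMF X, ν : PMF Y, F : X → PMF X', G : Y → PMF Y', and relations R : X → Y → Prop and R' : X' → Y' → Prop. Suppose there exists η : PMF (X × Y) with η.map Prod.fst = μ, η.map Prod.snd = ν, and R p.1 p.2 for every p in the support of η; and suppose that for all x and y with R x y there exists θ : PMF (X' × Y') with θ.map Prod.fst = F x, θ.map Prod.snd = G y, and R' q.1 q.2 for every q in the support of θ. Then there exists η' : PMF (X' × Y') with η'.map Prod.fst = μ.bind F, η'.map Prod.snd = ν.bind G, and R' q.1 q.2 for every q in the support of η'. -/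
/-- Binds agree when the continuations agree on the support. -/
theorem bind_congr_support_aux {A B : Type*} (p : PMF A) (f g : A → PMF B)
    (h : ∀ a ∈ p.support, f a = g a) : p.bind f = p.bind g := by
  ext b
  rw [PMF.bind_apply, PMF.bind_apply]
  refine tsum_congr fun a => ?_
  by_cases ha : p a = 0
  · simp [ha]
  · rw [h a ((PMF.mem_support_iff p a).2 ha)]

/-- Bind-compatibility of probabilistic lifting: a coupling on `R` together
with couplings on `R'` for the continuations yields a coupling on `R'` for the
monadic binds. -/
theorem coupling_bind {X Y X' Y' : Type*}
    (μ : PMF X) (ν : PMF Y) (F : X → PMF X') (G : Y → PMF Y')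
    (R : X → Y → Prop) (R' : X' → Y' → Prop)
    (hcoupling : ∃ η : PMF (X × Y),
      η.map Prod.fst = μ ∧ η.map Prod.snd = ν ∧
      ∀ p ∈ η.support, R p.1 p.2)
    (hcont : ∀ x y, R x y → ∃ θ : PMF (X' × Y'),
      θ.map Prod.fst = F x ∧ θ.map Prod.snd = G y ∧
      ∀ q ∈ θ.support, R' q.1 q.2) :
    ∃ η' : PMF (X' × Y'),
      η'.map Prod.fst = μ.bind F ∧ η'.map Prod.snd = ν.bind G ∧
      ∀ q ∈ η'.support, R' q.1 q.2 := by
  obtain ⟨η, rfl, rfl, hR⟩ := hcoupling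
  have key : ∀ p : X × Y, ∃ θ : PMF (X' × Y'), p ∈ η.support →
      θ.map Prod.fst = F p.1 ∧ θ.map Prod.snd = G p.2 ∧ ∀ q ∈ θ.support, R' q.1 q.2 := by
    intro p
    by_cases hp : p ∈ η.support
    · obtain ⟨θ, hθ⟩ := hcont p.1 p.2 (hR p hp)
      exact ⟨θ, fun _ => hθ⟩
    · exact ⟨(F p.1).bind fun a => (G p.2).map fun b => (a, b), fun h => absurd h hp⟩
  choose K hK using key
  refine ⟨η.bind K, ?_, ?_, ?_⟩
  · rw [PMF.map_bind, PMF.bind_map]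
    exact bind_congr_support_aux _ _ _ fun p hp => (hK p hp).1
  · rw [PMF.map_bind, PMF.bind_map]
    exact bind_congr_support_aux _ _ _ fun p hp => (hK p hp).2.1
  · intro q hq
    obtain ⟨p, hp, hq⟩ := (PMF.mem_support_bind_iff _ _ _).1 hq
    exact (hK p hp).2.2 q hq
end
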